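/- Proposition 5(1): In the left-censored disclosure model, in every truth-leaning equilibrium (σ, a, μ): for all e ∈ E, a(e) = μ(e) = min{V(e), ν({e})}. -/

import Mathlib

open scoped BigOperators

namespace LeftCensored

/-- Evidence: a finite sequence of binary signals; `true` stands for a high
return (`g`) and `false` for a low return (`b`). A sequence is a list whose
suffixes are the most recent signals. -/
abbrev Ev := List Bool

/-- `G(e)`: the number of `g`'s in `e`. -/
def Gc (e : Ev) : ℕ := e.count true

/-- `B(e)`: the number of `b`'s in `e`. -/
def Bc (e : Ev) : ℕ := e.count false

/-- `D(e) = G(e) − B(e)`. -/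
def D (e : Ev) : ℤ := (Gc e : ℤ) - (Bc e : ℤ)

/-- `N(e) = max_{0 ≤ k ≤ L(e)} D(e|_k)`, the maximum of `D` over all suffixes
(truncations from the left) of `e`; since the empty suffix gives `D = 0`, this
equals the fold of `max` over the suffixes starting from `0`. -/
def N (e : Ev) : ℤ := (e.tails.map D).foldr max 0

/-- The evidence distribution in the good state. -/
noncomputable def FG (p q : ℝ) (e : Ev) : ℝ := (1 - p - q) * p ^ Gc e * q ^ Bc e

/-- The evidence distribution in the bad state. -/
noncomputable def FB (p q : ℝ) (e : Ev) : ℝ := (1 - p - q) * p ^ Bc e * q ^ Gc e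

/-- Posterior belief `ν(A)` that the state is good given evidence in `A`. -/
noncomputable def nu (p q π0 : ℝ) (A : Set Ev) : ℝ :=
  ((∑' e : A, FG p q e) * π0) /
    ((∑' e : A, FG p q e) * π0 + (∑' e : A, FB p q e) * (1 - π0))

/-- `α = (1 − √(1 − 4pq))/2`. -/
noncomputable def alpha (p q : ℝ) : ℝ := (1 - Real.sqrt (1 - 4 * p * q)) / 2

/-- The sender's equilibrium value function (Proposition 4). -/
noncomputable def V (p q π0 : ℝ) (e : Ev) : ℝ :=
  1 / (1 + ((1 - π0) / π0) * ((p - alpha p q) / (q - alpha p q)) * (q / p) ^ (N e + 1))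

/-- `L` is a (nonempty) lower contour set in `A` with respect to the suffix
(left-censoring) order. -/
def IsLCS (A L : Set Ev) : Prop :=
  L.Nonempty ∧ L ⊆ A ∧ ∀ e ∈ L, ∀ e' ∈ A, e' <:+ e → e' ∈ L

/-- A truth-leaning equilibrium of the left-censored disclosure game (the
receiver's response `φ` is the identity). -/
structure Eqm (p q π0 : ℝ) where
  σ : Ev → Ev → ℝ
  act : Ev → ℝ
  μ : Ev → ℝ
  σ_nonneg : ∀ e m, 0 ≤ σ e m
  σ_hasSum : ∀ e, HasSum (σ e) 1
  feasible : ∀ e m, 0 < σ e m → m <:+ e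
  μ_mem : ∀ m, μ m ∈ Set.Icc (0 : ℝ) 1
  sender_opt : ∀ e m, 0 < σ e m → ∀ m', m' <:+ e → act m' ≤ act m
  receiver_opt : ∀ m, act m = μ m
  bayes : ∀ m, (∃ e, 0 < σ e m) →
    μ m = (∑' e : {e : Ev // m <:+ e}, σ e.1 m * FG p q e.1 * π0) /
      (∑' e : {e : Ev // m <:+ e}, σ e.1 m * (FG p q e.1 * π0 + FB p q e.1 * (1 - π0)))
  truth_leaning : ∀ e, (∀ m, m <:+ e → act m ≤ act e) → σ e e = 1
  offpath : ∀ m, (¬ ∃ e, 0 < σ e m) → μ m = nu p q π0 {m}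

end LeftCensored

namespace LeftCensored

/-! ### Counting and the running maximum -/

lemma D_cons_true (e : Ev) : D (true :: e) = D e + 1 := by
  simp [D, Gc, Bc]; ring

lemma D_cons_false (e : Ev) : D (false :: e) = D e - 1 := by
  simp [D, Gc, Bc]; ring

lemma N_cons (x : Bool) (e : Ev) : N (x :: e) = max (D (x :: e)) (N e) := by
  simp [N]

lemma D_le_N (e : Ev) : D e ≤ N e := by
  cases e with
  | nil => simp [N, D, Gc, Bc]
  | cons x e => rw [N_cons]; exact le_max_left _ _

lemma N_cons_false (e : Ev) : N (false :: e) = N e := by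
  rw [N_cons, D_cons_false]
  exact max_eq_right (by linarith [D_le_N e])

lemma N_mono {m e : Ev} (h : m <:+ e) : N m ≤ N e := by
  obtain ⟨t, rfl⟩ := h
  induction t with
  | nil => rfl
  | cons x t ih => rw [List.cons_append, N_cons]; exact ih.trans (le_max_right _ _)

/-- The drawdown `N(e) − D(e)`. -/
def drawdown (e : Ev) : ℕ := (N e - D e).toNat

lemma drawdown_cast (e : Ev) : (drawdown e : ℤ) = N e - D e :=
  Int.toNat_of_nonneg (sub_nonneg.2 (D_le_N e))

lemma drawdown_cons_false (e : Ev) : drawdown (false :: e) = drawdown e + 1 := by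
  have h1 := drawdown_cast e
  have h2 := drawdown_cast (false :: e)
  rw [N_cons_false, D_cons_false] at h2
  omega

lemma cons_true_of_drawdown_eq_zero {e : Ev} (h : drawdown e = 0) :
    drawdown (true :: e) = 0 := by
  have h1 := drawdown_cast e
  have h2 := drawdown_cast (true :: e)
  rw [N_cons, D_cons_true] at h2
  omega

lemma cons_true_of_drawdown_eq_succ {e : Ev} {k : ℕ} (h : drawdown e = k + 1) :
    drawdown (true :: e) = k ∧ N (true :: e) = N e := by
  have h1 := drawdown_cast e
  have h2 := drawdown_cast (true :: e)
  have h3 := N_cons true e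
  rw [D_cons_true] at h2 h3
  omega

/-! ### Sums over sequences -/

/-- The weight `p^G(e) q^B(e)` of a sequence. -/
noncomputable def wt (p q : ℝ) (e : Ev) : ℝ := p ^ Gc e * q ^ Bc e

lemma wt_pos {p q : ℝ} (hp : 0 < p) (hq : 0 < q) (e : Ev) : 0 < wt p q e := by
  unfold wt; positivity

lemma wt_cons_true (p q : ℝ) (e : Ev) : wt p q (true :: e) = p * wt p q e := by
  simp [wt, Gc, Bc, pow_succ]; ring

lemma wt_cons_false (p q : ℝ) (e : Ev) : wt p q (false :: e) = q * wt p q e := by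
  simp [wt, Gc, Bc, pow_succ]; ring

lemma FG_eq (p q : ℝ) (e : Ev) : FG p q e = (1 - p - q) * wt p q e := by
  simp [FG, wt, mul_assoc]

lemma FB_eq (p q : ℝ) (e : Ev) : FB p q e = (1 - p - q) * wt q p e := by
  simp [FB, wt]; ring

lemma wt_ofFn (p q : ℝ) (n : ℕ) (f : Fin n → Bool) :
    wt p q (List.ofFn f) = ∏ i, (if f i then p else q) := by
  induction n with
  | zero => simp [wt, Gc, Bc]
  | succ n ih =>
    rw [List.ofFn_succ, Fin.prod_univ_succ, ← ih]
    cases f 0 <;> simp [wt_cons_true, wt_cons_false]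

lemma summable_wt {p q : ℝ} (hp : 0 < p) (hq : 0 < q) (hpq : p + q < 1) :
    Summable (wt p q) := by
  rw [← (List.equivSigmaTuple (α := Bool)).symm.summable_iff,
    summable_sigma_of_nonneg (f := wt p q ∘ (List.equivSigmaTuple (α := Bool)).symm)
      (fun _ => (wt_pos hp hq _).le)]
  refine ⟨fun n => Summable.of_finite, ?_⟩
  have h : ∀ n : ℕ, ∑' f : Fin n → Bool,
      (wt p q ∘ (List.equivSigmaTuple (α := Bool)).symm) ⟨n, f⟩ = (p + q) ^ n := by
    intro n
    rw [tsum_fintype]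
    have := Fintype.sum_pow (fun b : Bool => if b then p else q) n
    rw [Fintype.sum_bool] at this
    simp only [if_true, Bool.false_eq_true, if_false] at this
    rw [this]
    exact Finset.sum_congr rfl fun f _ => wt_ofFn p q n f
  simp only [h]
  exact summable_geometric_of_lt_one (by positivity) hpq

lemma tsum_eq_tsum_cons {f : Ev → ℝ} (hf : Summable f) (h : f [] = 0) :
    ∑' e, f e = ∑' e, (f (true :: e) + f (false :: e)) := by
  have hinj : Function.Injective (fun x : Bool × Ev => x.1 :: x.2) := by
    rintro ⟨a, b⟩ ⟨c, d⟩ h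
    simpa using h
  have hsup : Function.support f ⊆ Set.range (fun x : Bool × Ev => x.1 :: x.2) := by
    intro e he
    cases e with
    | nil => exact absurd h he
    | cons x e => exact ⟨(x, e), rfl⟩
  have hs : Summable (fun x : Bool × Ev => f (x.1 :: x.2)) := hf.comp_injective hinj
  have hb : ∀ b : Bool, Summable fun e => f (b :: e) := fun b =>
    hf.comp_injective (List.cons_injective (a := b))
  rw [← hinj.tsum_eq hsup, hs.tsum_prod, tsum_fintype, Fintype.sum_bool,
    (hb true).tsum_add (hb false)]

/-! ### The root `α` -/

lemma alpha_sq {p q : ℝ} (hpq : 4 * p * q ≤ 1) : alpha p q ^ 2 = alpha p q - p * q := by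
  have := Real.sq_sqrt (x := 1 - 4 * p * q) (by linarith)
  unfold alpha
  linear_combination this / 4

lemma alpha_pos {p q : ℝ} (hp : 0 < p) (hq : 0 < q) : 0 < alpha p q := by
  have : Real.sqrt (1 - 4 * p * q) < 1 := by
    rw [Real.sqrt_lt' one_pos]
    nlinarith [mul_pos hp hq]
  unfold alpha; linarith

lemma alpha_lt {p q : ℝ} (hq : 0 < q) (hpq : p + q < 1) : alpha p q < q := by
  have : 1 - 2 * q < Real.sqrt (1 - 4 * p * q) := by
    apply Real.lt_sqrt_of_sq_lt
    nlinarith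
  unfold alpha; linarith

/-! ### The flux kernel -/

/-- Up to a positive factor, the total weight `∑ F_G π₀ (1 - V) - F_B (1 - π₀) V` of the
sequences that extend a sequence of drawdown `k` without increasing its running maximum. -/
noncomputable def kernel (p q : ℝ) (k : ℕ) : ℝ :=
  (p - alpha p q) / (q - alpha p q) * (q / p) ^ (k + 1) * (1 - (alpha p q / q) ^ (k + 1)) -
    (1 - (alpha p q / p) ^ (k + 1))

lemma geom_ratio_le {r s : ℝ} (hr : 0 ≤ r) (hs : 0 ≤ s) (hs1 : s ≤ 1) (hr1 : r ≤ 1) (k : ℕ) :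
    (1 - s * r) * s ^ k * (1 - r ^ (k + 1)) ≤ (1 - r) * (1 - (s * r) ^ (k + 1)) := by
  have hsum : s ^ k * ∑ j ∈ Finset.range (k + 1), r ^ j ≤
      ∑ j ∈ Finset.range (k + 1), (s * r) ^ j := by
    rw [Finset.mul_sum]
    refine Finset.sum_le_sum fun j hj => ?_
    rw [mul_pow]
    exact mul_le_mul_of_nonneg_right
      (pow_le_pow_of_le_one hs hs1 (Nat.lt_succ_iff.1 (Finset.mem_range.1 hj))) (by positivity)
  have h1 := mul_neg_geom_sum r (k + 1)
  have h2 := mul_neg_geom_sum (s * r) (k + 1)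
  rw [← h1, ← h2]
  have h3 : 0 ≤ (1 - s * r) * (1 - r) :=
    mul_nonneg (by nlinarith) (by linarith)
  nlinarith [mul_le_mul_of_nonneg_left hsum h3]

lemma kernel_zero {p q : ℝ} (hq0 : 0 < q) (hqp : q < p) (hpq1 : p + q < 1) :
    kernel p q 0 = 0 := by
  have hα := alpha_lt hq0 hpq1
  have hp : p ≠ 0 := by linarith
  have hq : q ≠ 0 := hq0.ne'
  have : q - alpha p q ≠ 0 := by linarith
  simp only [kernel, zero_add, pow_one]
  field_simp
  ring

lemma kernel_nonpos {p q : ℝ} (hq0 : 0 < q) (hqp : q < p) (hpq1 : p + q < 1)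
    (k : ℕ) : kernel p q k ≤ 0 := by
  have hα := alpha_lt hq0 hpq1
  have hα0 := alpha_pos (hq0.trans hqp) hq0
  have hp : 0 < p := hq0.trans hqp
  have hd : 0 < q - alpha p q := by linarith
  have h := geom_ratio_le (r := alpha p q / q) (s := q / p) (by positivity) (by positivity)
    ((div_le_one hp).2 hqp.le) ((div_le_one hq0).2 hα.le) k
  have hsr : q / p * (alpha p q / q) = alpha p q / p := by field_simp
  rw [hsr] at h
  have hr : 0 < 1 - alpha p q / q := by
    rw [sub_pos, div_lt_one hq0]; exact hα
  have hk : (1 - alpha p q / q) * kernel p q k =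
      (1 - alpha p q / p) * (q / p) ^ k * (1 - (alpha p q / q) ^ (k + 1)) -
        (1 - alpha p q / q) * (1 - (alpha p q / p) ^ (k + 1)) := by
    have : (1 - alpha p q / q) * ((p - alpha p q) / (q - alpha p q) * (q / p)) =
        1 - alpha p q / p := by field_simp
    unfold kernel
    linear_combination (q / p) ^ k * (1 - (alpha p q / q) ^ (k + 1)) * this
  nlinarith

lemma neg_one_le_kernel {p q : ℝ} (hq0 : 0 < q) (hqp : q < p) (hpq1 : p + q < 1)
    (k : ℕ) : -1 ≤ kernel p q k := by
  have hα := alpha_lt hq0 hpq1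
  have hp : 0 < p := hq0.trans hqp
  have hα0 := alpha_pos hp hq0
  have h1 : 0 ≤ 1 - (alpha p q / q) ^ (k + 1) :=
    sub_nonneg.2 (pow_le_one₀ (by positivity) ((div_le_one hq0).2 hα.le))
  have h2 : 0 ≤ (p - alpha p q) / (q - alpha p q) :=
    div_nonneg (by linarith) (by linarith)
  have h3 : 0 ≤ (p - alpha p q) / (q - alpha p q) * (q / p) ^ (k + 1) *
      (1 - (alpha p q / q) ^ (k + 1)) := mul_nonneg (mul_nonneg h2 (by positivity)) h1
  have h4 : 0 ≤ (alpha p q / p) ^ (k + 1) := by positivity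
  unfold kernel
  linarith

lemma kernel_rec_zero {p q : ℝ} (hq0 : 0 < q) (hqp : q < p) (hpq1 : p + q < 1) :
    (1 - p - q) * ((p - alpha p q) / (q - alpha p q) * (q / p) - 1) =
    kernel p q 0 - p * kernel p q 1 := by
  have hα := alpha_lt hq0 hpq1
  have hp : p ≠ 0 := by linarith
  have hq : q ≠ 0 := hq0.ne'
  have hd : q - alpha p q ≠ 0 := by linarith
  have h4 : 4 * p * q ≤ 1 := by nlinarith [sq_nonneg (p - q)]
  have hsq := alpha_sq h4
  unfold kernel
  generalize alpha p q = a at *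
  have h1 : q * (a / q) ^ 2 - a / q + p = 0 := by field_simp; linear_combination hsq
  have h2 : p * (a / p) ^ 2 - a / p + q = 0 := by field_simp; linear_combination hsq
  have h3 : p * (q / p) = q := by field_simp
  generalize (p - a) / (q - a) = R at *
  generalize a / q = r at *
  generalize a / p = r' at *
  generalize q / p = s at *
  linear_combination (-R * s) * h1 + h2 + R * (1 - r ^ 2) * s * h3

lemma kernel_rec_succ {p q : ℝ} (hq0 : 0 < q) (hqp : q < p) (hpq1 : p + q < 1)
    (k : ℕ) :
    (1 - p - q) * ((p - alpha p q) / (q - alpha p q) * (q / p) ^ (k + 2) - 1) =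
      kernel p q (k + 1) - q * kernel p q k - p * kernel p q (k + 2) := by
  have hα := alpha_lt hq0 hpq1
  have hp : p ≠ 0 := by linarith
  have hq : q ≠ 0 := hq0.ne'
  have hd : q - alpha p q ≠ 0 := by linarith
  have h4 : 4 * p * q ≤ 1 := by nlinarith [sq_nonneg (p - q)]
  have hsq := alpha_sq h4
  unfold kernel
  generalize alpha p q = a at *
  have h1 : q * (a / q) ^ 2 - a / q + p = 0 := by field_simp; linear_combination hsq
  have h2 : p * (a / p) ^ 2 - a / p + q = 0 := by field_simp; linear_combination hsq
  have h3 : p * (q / p) = q := by field_simp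
  generalize (p - a) / (q - a) = R at *
  generalize a / q = r at *
  generalize a / p = r' at *
  generalize q / p = s at *
  linear_combination (-R * s ^ (k + 2) * r ^ (k + 1)) * h1 + r' ^ (k + 1) * h2 +
    (R * (1 - r ^ (k + 3)) * s ^ (k + 2) - R * (1 - r ^ (k + 1)) * s ^ (k + 1)) * h3

/-! ### The value function -/

lemma summable_mul_of_abs_le_one {ι : Type*} {f g : ι → ℝ} (hf : Summable f)
    (hg : ∀ i, |g i| ≤ 1) : Summable fun i => f i * g i := by
  refine Summable.of_norm_bounded hf.norm fun i => ?_
  rw [norm_mul]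
  exact mul_le_of_le_one_right (norm_nonneg _) (hg i)

/-- The evidence distribution averaged over the prior. -/
noncomputable def mass (p q π0 : ℝ) (e : Ev) : ℝ := FG p q e * π0 + FB p q e * (1 - π0)

/-- The weight `F_G(e) π₀ (1 - v) - F_B(e) (1 - π₀) v`, written in terms of `mass`. -/
noncomputable def excess (p q π0 v : ℝ) (e : Ev) : ℝ := FG p q e * π0 - v * mass p q π0 e

/-- The total excess over `V` flowing through `e`. -/
noncomputable def flux (p q π0 : ℝ) (e : Ev) : ℝ :=
  V p q π0 e * (1 - π0) * wt q p e * kernel p q (drawdown e)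

lemma nu_singleton (p q π0 : ℝ) (e : Ev) :
    nu p q π0 {e} = FG p q e * π0 / mass p q π0 e := by
  simp only [nu, mass, tsum_singleton e (fun x => FG p q x),
    tsum_singleton e (fun x => FB p q x)]

lemma V_congr {p q π0 : ℝ} {e e' : Ev} (h : N e = N e') : V p q π0 e = V p q π0 e' := by
  simp only [V, h]

/-- The hypotheses on the parameters. -/
structure Params (p q π0 : ℝ) : Prop where
  q_pos : 0 < q
  lt : q < p
  add_lt : p + q < 1
  prior_pos : 0 < π0
  prior_lt : π0 < 1

namespace Params

variable {p q π0 : ℝ}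

lemma p_pos (P : Params p q π0) : 0 < p := P.q_pos.trans P.lt

lemma FG_pos (P : Params p q π0) (e : Ev) : 0 < FG p q e := by
  rw [FG_eq]
  exact mul_pos (by linarith [P.add_lt]) (wt_pos P.p_pos P.q_pos e)

lemma FB_pos (P : Params p q π0) (e : Ev) : 0 < FB p q e := by
  rw [FB_eq]
  exact mul_pos (by linarith [P.add_lt]) (wt_pos P.q_pos P.p_pos e)

lemma FG_prior_lt_mass (P : Params p q π0) (e : Ev) : FG p q e * π0 < mass p q π0 e :=
  lt_add_of_pos_right _ (mul_pos (P.FB_pos e) (sub_pos.2 P.prior_lt))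

lemma FG_prior_pos (P : Params p q π0) (e : Ev) : 0 < FG p q e * π0 :=
  mul_pos (P.FG_pos e) P.prior_pos

lemma mass_pos (P : Params p q π0) (e : Ev) : 0 < mass p q π0 e :=
  (P.FG_prior_pos e).trans (P.FG_prior_lt_mass e)

lemma summable_mass (P : Params p q π0) : Summable (mass p q π0) := by
  have h1 := summable_wt P.p_pos P.q_pos P.add_lt
  have h2 := summable_wt P.q_pos P.p_pos (by linarith [P.add_lt])
  refine (((h1.mul_left (1 - p - q)).mul_right π0).add
    ((h2.mul_left (1 - p - q)).mul_right (1 - π0))).congr fun e => ?_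
  simp only [mass, FG_eq, FB_eq]

lemma abs_excess_le (P : Params p q π0) {v : ℝ} (h0 : 0 ≤ v) (h1 : v ≤ 1) (e : Ev) :
    |excess p q π0 v e| ≤ mass p q π0 e := by
  have := P.FG_prior_lt_mass e
  have := P.FG_prior_pos e
  have := P.mass_pos e
  rw [abs_le]
  unfold excess
  constructor <;> nlinarith

lemma V_ratio_pos (P : Params p q π0) :
    0 < (1 - π0) / π0 * ((p - alpha p q) / (q - alpha p q)) := by
  have h1 := alpha_lt P.q_pos P.add_lt
  have h2 := P.lt
  exact mul_pos (div_pos (sub_pos.2 P.prior_lt) P.prior_pos)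
    (div_pos (by linarith) (by linarith))

lemma V_denom_pos (P : Params p q π0) (n : ℤ) :
    0 < 1 + (1 - π0) / π0 * ((p - alpha p q) / (q - alpha p q)) * (q / p) ^ n := by
  have := mul_pos P.V_ratio_pos (zpow_pos (div_pos P.q_pos P.p_pos) n)
  linarith

lemma V_pos (P : Params p q π0) (e : Ev) : 0 < V p q π0 e := one_div_pos.2 (P.V_denom_pos _)

lemma V_le_one (P : Params p q π0) (e : Ev) : V p q π0 e ≤ 1 := by
  have := mul_pos P.V_ratio_pos (zpow_pos (div_pos P.q_pos P.p_pos) (N e + 1))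
  exact (div_le_one (P.V_denom_pos _)).2 (by linarith)

lemma V_mono (P : Params p q π0) {m e : Ev} (h : m <:+ e) : V p q π0 m ≤ V p q π0 e := by
  refine one_div_le_one_div_of_le (P.V_denom_pos _) ?_
  have := zpow_le_zpow_right_of_le_one₀ (div_pos P.q_pos P.p_pos)
    ((div_le_one P.p_pos).2 P.lt.le) (show N m + 1 ≤ N e + 1 by linarith [N_mono h])
  have := mul_le_mul_of_nonneg_left this P.V_ratio_pos.le
  linarith

lemma zpow_D_mul_wt (P : Params p q π0) (e : Ev) : (q / p) ^ D e * wt p q e = wt q p e := by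
  have hp := P.p_pos.ne'
  have hq := P.q_pos.ne'
  unfold D wt
  rw [zpow_sub₀ (div_ne_zero hq hp), zpow_natCast, zpow_natCast, div_pow, div_pow]
  field_simp

lemma excess_V (P : Params p q π0) (e : Ev) :
    excess p q π0 (V p q π0 e) e = V p q π0 e * (1 - π0) * wt q p e *
      ((1 - p - q) *
        ((p - alpha p q) / (q - alpha p q) * (q / p) ^ (drawdown e + 1) - 1)) := by
  have hs : (0 : ℝ) < q / p := div_pos P.q_pos P.p_pos
  have hN : N e + 1 = D e + ((drawdown e + 1 : ℕ) : ℤ) := by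
    push_cast; rw [drawdown_cast]; ring
  have hz : (q / p) ^ (N e + 1) * wt p q e = (q / p) ^ (drawdown e + 1) * wt q p e := by
    rw [hN, zpow_add₀ hs.ne', zpow_natCast, ← P.zpow_D_mul_wt e]; ring
  have hV : V p q π0 e *
      (1 + (1 - π0) / π0 * ((p - alpha p q) / (q - alpha p q)) * (q / p) ^ (N e + 1)) = 1 :=
    one_div_mul_cancel (P.V_denom_pos _).ne'
  have hπ : π0 * ((1 - π0) / π0) = 1 - π0 := mul_div_cancel₀ _ P.prior_pos.ne'
  simp only [excess, mass, FG_eq, FB_eq]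
  generalize (p - alpha p q) / (q - alpha p q) = R at *
  generalize V p q π0 e = v at *
  generalize (q / p) ^ (N e + 1) = z at *
  generalize (q / p) ^ (drawdown e + 1) = y at *
  generalize (1 - π0) / π0 = t at *
  linear_combination (-(1 - p - q) * wt p q e * π0) * hV +
    v * (1 - p - q) * R * (1 - π0) * hz + v * (1 - p - q) * R * z * wt p q e * hπ

lemma flux_nonpos (P : Params p q π0) (e : Ev) : flux p q π0 e ≤ 0 :=
  mul_nonpos_of_nonneg_of_nonpos
    (mul_nonneg (mul_nonneg (P.V_pos e).le (sub_nonneg.2 P.prior_lt.le))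
      (wt_pos P.q_pos P.p_pos e).le)
    (kernel_nonpos P.q_pos P.lt P.add_lt _)

lemma flux_eq_zero (P : Params p q π0) {e : Ev} (h : drawdown e = 0) : flux p q π0 e = 0 := by
  rw [flux, h, kernel_zero P.q_pos P.lt P.add_lt, mul_zero]

lemma excess_V_eq_flux (P : Params p q π0) (e : Ev) :
    excess p q π0 (V p q π0 e) e =
      flux p q π0 e - flux p q π0 (true :: e) - flux p q π0 (false :: e) := by
  have hf : flux p q π0 (false :: e) =
      V p q π0 e * (1 - π0) * (p * wt q p e) * kernel p q (drawdown e + 1) := by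
    rw [flux, V_congr (N_cons_false e), wt_cons_false, drawdown_cons_false]
  rw [P.excess_V, hf]
  rcases hk : drawdown e with _ | k
  · rw [P.flux_eq_zero (cons_true_of_drawdown_eq_zero hk), flux, hk]
    linear_combination V p q π0 e * (1 - π0) * wt q p e *
      kernel_rec_zero P.q_pos P.lt P.add_lt
  · obtain ⟨h1, h2⟩ := cons_true_of_drawdown_eq_succ hk
    rw [flux, flux, h1, V_congr h2, wt_cons_true, hk]
    linear_combination V p q π0 e * (1 - π0) * wt q p e *
      kernel_rec_succ P.q_pos P.lt P.add_lt k

lemma summable_flux (P : Params p q π0) : Summable (flux p q π0) := by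
  have hs := summable_wt P.q_pos P.p_pos (by linarith [P.add_lt])
  refine Summable.of_norm_bounded hs fun e => ?_
  have hw := wt_pos P.q_pos P.p_pos e
  have hk : |kernel p q (drawdown e)| ≤ 1 := abs_le.2
    ⟨neg_one_le_kernel P.q_pos P.lt P.add_lt _,
      (kernel_nonpos P.q_pos P.lt P.add_lt _).trans zero_le_one⟩
  have hV : V p q π0 e * (1 - π0) ≤ 1 :=
    mul_le_one₀ (P.V_le_one e) (sub_nonneg.2 P.prior_lt.le) (by linarith [P.prior_pos])
  have hV0 : 0 ≤ V p q π0 e * (1 - π0) :=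
    mul_nonneg (P.V_pos e).le (sub_nonneg.2 P.prior_lt.le)
  rw [flux, Real.norm_eq_abs, abs_mul, abs_of_nonneg (mul_nonneg hV0 hw.le)]
  exact (mul_le_of_le_one_right (mul_nonneg hV0 hw.le) hk).trans
    (mul_le_of_le_one_left hw.le hV)

/-- The excess over `V` is negatively correlated with every `h` that is monotone along
sequences that keep the running maximum. -/
lemma tsum_excess_V_mul_nonpos (P : Params p q π0) {h : Ev → ℝ} (hb : ∀ e, |h e| ≤ 1)
    (hfalse : ∀ e, h e ≤ h (false :: e))
    (htrue : ∀ e, N (true :: e) = N e → h e ≤ h (true :: e)) :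
    ∑' e, excess p q π0 (V p q π0 e) e * h e ≤ 0 := by
  have hs := P.summable_flux
  have hst : Summable fun e => flux p q π0 (true :: e) := hs.comp_injective List.cons_injective
  have hsf : Summable fun e => flux p q π0 (false :: e) := hs.comp_injective List.cons_injective
  have hcons := tsum_eq_tsum_cons (summable_mul_of_abs_le_one hs hb)
    (by rw [P.flux_eq_zero (by simp [drawdown, N, D, Gc, Bc]), zero_mul])
  have hsplit : ∑' e, excess p q π0 (V p q π0 e) e * h e =
      ∑' e, flux p q π0 e * h e -
        ∑' e, (flux p q π0 (true :: e) * h e + flux p q π0 (false :: e) * h e) := by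
    rw [← (summable_mul_of_abs_le_one hs hb).tsum_sub
      ((summable_mul_of_abs_le_one hst hb).add
        (summable_mul_of_abs_le_one hsf hb))]
    refine tsum_congr fun e => ?_
    rw [P.excess_V_eq_flux]; ring
  rw [hsplit, hcons, sub_nonpos]
  refine Summable.tsum_le_tsum (fun e => add_le_add ?_ ?_)
    ((summable_mul_of_abs_le_one hst fun e => hb (true :: e)).add
      (summable_mul_of_abs_le_one hsf fun e => hb (false :: e)))
    ((summable_mul_of_abs_le_one hst hb).add (summable_mul_of_abs_le_one hsf hb))
  · rcases hk : drawdown e with _ | k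
    · rw [P.flux_eq_zero (cons_true_of_drawdown_eq_zero hk), zero_mul, zero_mul]
    · exact mul_le_mul_of_nonpos_left (htrue e (cons_true_of_drawdown_eq_succ hk).2)
        (P.flux_nonpos _)
  · exact mul_le_mul_of_nonpos_left (hfalse e) (P.flux_nonpos _)

end Params

/-! ### Equilibrium -/

namespace Eqm

variable {p q π0 : ℝ} (Q : Eqm p q π0)

lemma exists_report (e : Ev) : ∃ m, 0 < Q.σ e m := by
  by_contra! h
  have h0 : Q.σ e = 0 := funext fun m => le_antisymm (h m) (Q.σ_nonneg e m)
  have := Q.σ_hasSum e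
  rw [h0] at this
  exact zero_ne_one (hasSum_zero.unique this)

/-- The sender's equilibrium payoff. -/
noncomputable def payoff (e : Ev) : ℝ := Q.act (Q.exists_report e).choose

lemma act_le_payoff {m e : Ev} (h : m <:+ e) : Q.act m ≤ Q.payoff e :=
  Q.sender_opt e _ (Q.exists_report e).choose_spec m h

lemma act_eq_payoff {m e : Ev} (h : 0 < Q.σ e m) : Q.act m = Q.payoff e :=
  le_antisymm (Q.act_le_payoff (Q.feasible e m h))
    (Q.sender_opt e m h _ (Q.feasible e _ (Q.exists_report e).choose_spec))

lemma payoff_mono {m e : Ev} (h : m <:+ e) : Q.payoff m ≤ Q.payoff e :=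
  Q.act_le_payoff ((Q.feasible m _ (Q.exists_report m).choose_spec).trans h)

lemma payoff_mem (e : Ev) : Q.payoff e ∈ Set.Icc (0 : ℝ) 1 := by
  rw [payoff, Q.receiver_opt]; exact Q.μ_mem _

lemma act_mem (e : Ev) : Q.act e ∈ Set.Icc (0 : ℝ) 1 := by
  rw [Q.receiver_opt]; exact Q.μ_mem _

lemma act_eq_payoff_self {m e : Ev} (h : 0 < Q.σ e m) : Q.act m = Q.payoff m :=
  le_antisymm (Q.act_le_payoff List.suffix_rfl)
    (Q.act_eq_payoff h ▸ Q.payoff_mono (Q.feasible e m h))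

lemma σ_self {e : Ev} (h : Q.act e = Q.payoff e) : Q.σ e e = 1 :=
  Q.truth_leaning e fun _ hm => (Q.act_le_payoff hm).trans_eq h.symm

lemma σ_eq_zero_of_ne {m e : Ev} (h : Q.act e = Q.payoff e) (hne : m ≠ e) : Q.σ e m = 0 := by
  have h1 : Q.σ e e + Q.σ e m ≤ 1 := by
    have := sum_le_hasSum {e, m} (fun i _ => Q.σ_nonneg e i) (Q.σ_hasSum e)
    rwa [Finset.sum_pair hne.symm] at this
  rw [Q.σ_self h] at h1
  exact le_antisymm (by linarith) (Q.σ_nonneg e m)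

/-- Evidence that is not worth its sender's payoff is off path and taken at face value. -/
lemma act_eq_nu {e : Ev} (h : Q.act e ≠ Q.payoff e) : Q.act e = nu p q π0 {e} := by
  rw [Q.receiver_opt]
  exact Q.offpath e fun ⟨_, he⟩ => h (Q.act_eq_payoff_self he)

lemma σ_le_one (e m : Ev) : Q.σ e m ≤ 1 :=
  le_hasSum (Q.σ_hasSum e) m fun i _ => Q.σ_nonneg e i

lemma excess_nonpos_of_report (P : Params p q π0) {m e : Ev} (h : 0 < Q.σ e m) (hne : m ≠ e) :
    excess p q π0 (Q.act m) e ≤ 0 := by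
  have hact : Q.act e ≠ Q.payoff e := fun h' => h.ne' (Q.σ_eq_zero_of_ne h' hne)
  have hlt : FG p q e * π0 / mass p q π0 e ≤ Q.act m := by
    rw [← nu_singleton, ← Q.act_eq_nu hact, Q.act_eq_payoff h]
    exact Q.act_le_payoff List.suffix_rfl
  rw [div_le_iff₀ (P.mass_pos e)] at hlt
  exact sub_nonpos.2 hlt

lemma summable_σ_mul {f : Ev → ℝ} (hf : Summable f) (m : Ev) :
    Summable fun e => Q.σ e m * f e :=
  (summable_mul_of_abs_le_one hf fun e => abs_le.2
    ⟨by linarith [Q.σ_nonneg e m], Q.σ_le_one e m⟩).congr fun e => mul_comm _ _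

lemma summable_excess (P : Params p q π0) {v : Ev → ℝ} (hv : ∀ e, v e ∈ Set.Icc (0 : ℝ) 1) :
    Summable fun e => excess p q π0 (v e) e :=
  Summable.of_norm_bounded P.summable_mass fun e => P.abs_excess_le (hv e).1 (hv e).2 e

lemma tsum_σ_mul_excess (P : Params p q π0) (m : Ev) :
    ∑' e, Q.σ e m * excess p q π0 (Q.act m) e = 0 := by
  by_cases hm : ∃ e, 0 < Q.σ e m
  · obtain ⟨e₀, he₀⟩ := hm
    have hsupp : ∀ f : Ev → ℝ,
        Function.support (fun e => Q.σ e m * f e) ⊆ {e : Ev | m <:+ e} := by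
      intro f e he
      exact Q.feasible e m ((Q.σ_nonneg e m).lt_of_ne' (left_ne_zero_of_mul he))
    have hG : Summable fun e => FG p q e * π0 :=
      P.summable_mass.of_nonneg_of_le (fun e => (P.FG_prior_pos e).le)
        fun e => (P.FG_prior_lt_mass e).le
    have hmass := Q.summable_σ_mul P.summable_mass m
    have hb := Q.bayes m ⟨e₀, he₀⟩
    have hnum : ∑' e : {e : Ev // m <:+ e}, Q.σ e.1 m * FG p q e.1 * π0 =
        ∑' e, Q.σ e m * (FG p q e * π0) := by
      rw [← tsum_subtype_eq_of_support_subset (hsupp fun e => FG p q e * π0)]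
      exact tsum_congr fun e => mul_assoc _ _ _
    have hden : ∑' e : {e : Ev // m <:+ e},
        Q.σ e.1 m * (FG p q e.1 * π0 + FB p q e.1 * (1 - π0)) =
        ∑' e, Q.σ e m * mass p q π0 e :=
      tsum_subtype_eq_of_support_subset (hsupp (mass p q π0))
    have hpos : 0 < ∑' e, Q.σ e m * mass p q π0 e :=
      hmass.tsum_pos (fun e => mul_nonneg (Q.σ_nonneg e m) (P.mass_pos e).le) e₀
        (mul_pos he₀ (P.mass_pos e₀))
    rw [hnum, hden, ← Q.receiver_opt, eq_div_iff hpos.ne', ← tsum_mul_left] at hb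
    have hsub := (Q.summable_σ_mul hG m).tsum_sub (hmass.mul_left (Q.act m))
    rw [hb, sub_self] at hsub
    rw [← hsub]
    exact tsum_congr fun e => by rw [excess]; ring
  · have h0 : ∀ e, Q.σ e m = 0 := fun e =>
      le_antisymm (not_lt.1 fun h => hm ⟨e, h⟩) (Q.σ_nonneg e m)
    simp [h0]

lemma act_le_nu (P : Params p q π0) (e : Ev) : Q.act e ≤ nu p q π0 {e} := by
  by_cases h : Q.act e = Q.payoff e
  · rw [nu_singleton, le_div_iff₀ (P.mass_pos e), ← sub_nonneg]
    change 0 ≤ excess p q π0 (Q.act e) e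
    by_contra! hneg
    have hs := Q.summable_σ_mul (summable_excess P fun _ => Q.act_mem e) e
    have hle : ∀ e', Q.σ e' e * excess p q π0 (Q.act e) e' ≤ 0 := by
      intro e'
      rcases (Q.σ_nonneg e' e).eq_or_lt with h0 | hpos
      · rw [← h0, zero_mul]
      · refine mul_nonpos_of_nonneg_of_nonpos hpos.le ?_
        by_cases hne : e = e'
        · exact hne ▸ hneg.le
        · exact Q.excess_nonpos_of_report P hpos hne
    have := hs.neg.tsum_pos (fun e' => neg_nonneg.2 (hle e')) e
      (by rw [Q.σ_self h, one_mul]; exact neg_pos.2 hneg)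
    rw [tsum_neg, Q.tsum_σ_mul_excess P e] at this
    simp at this
  · exact (Q.act_eq_nu h).le

lemma act_eq_min (P : Params p q π0) (e : Ev) :
    Q.act e = min (Q.payoff e) (nu p q π0 {e}) := by
  by_cases h : Q.act e = Q.payoff e
  · rw [← h, min_eq_left (Q.act_le_nu P e)]
  · rw [← Q.act_eq_nu h, min_eq_right (Q.act_le_payoff List.suffix_rfl)]

lemma summable_σ_mul_mass (P : Params p q π0) :
    Summable fun x : Ev × Ev => Q.σ x.1 x.2 * mass p q π0 x.1 := by
  have h0 : (0 : Ev × Ev → ℝ) ≤ fun x => Q.σ x.1 x.2 * mass p q π0 x.1 :=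
    fun x => mul_nonneg (Q.σ_nonneg _ _) (P.mass_pos _).le
  refine (summable_prod_of_nonneg h0).2
    ⟨fun e => (Q.σ_hasSum e).summable.mul_right (mass p q π0 e), ?_⟩
  refine P.summable_mass.congr fun e => ?_
  dsimp only
  rw [tsum_mul_right, (Q.σ_hasSum e).tsum_eq, one_mul]

/-- The excess over the equilibrium payoff is negatively correlated with `f - payoff` for
every monotone `f`. -/
lemma tsum_excess_payoff_mul_nonpos (P : Params p q π0) {f : Ev → ℝ}
    (hf : ∀ e, f e ∈ Set.Icc (0 : ℝ) 1) (hmono : ∀ {m e : Ev}, m <:+ e → f m ≤ f e) :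
    ∑' e, excess p q π0 (Q.payoff e) e * (f e - Q.payoff e) ≤ 0 := by
  have hb : ∀ e, |f e - Q.payoff e| ≤ 1 := fun e => abs_le.2
    ⟨by linarith [(hf e).1, (Q.payoff_mem e).2], by linarith [(hf e).2, (Q.payoff_mem e).1]⟩
  obtain ⟨F, hFdef⟩ : ∃ F : Ev → Ev → ℝ, ∀ e m,
      F e m = Q.σ e m * excess p q π0 (Q.act m) e * (f e - Q.payoff e) := ⟨_, fun _ _ => rfl⟩
  have hF : Summable (Function.uncurry F) := by
    refine Summable.of_norm_bounded (Q.summable_σ_mul_mass P) ?_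
    rintro ⟨e, m⟩
    simp only [Function.uncurry, hFdef, Real.norm_eq_abs, abs_mul, abs_of_nonneg (Q.σ_nonneg e m)]
    refine (mul_le_of_le_one_right (mul_nonneg (Q.σ_nonneg e m) (abs_nonneg _))
      (hb e)).trans ?_
    exact mul_le_mul_of_nonneg_left (P.abs_excess_le (Q.act_mem m).1 (Q.act_mem m).2 e)
      (Q.σ_nonneg e m)
  have hrow : ∀ e, ∑' m, F e m = excess p q π0 (Q.payoff e) e * (f e - Q.payoff e) := by
    intro e
    have : ∀ m, F e m =
        Q.σ e m * (excess p q π0 (Q.payoff e) e * (f e - Q.payoff e)) := by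
      intro m
      rw [hFdef]
      rcases (Q.σ_nonneg e m).eq_or_lt with h0 | hpos
      · simp [← h0]
      · rw [Q.act_eq_payoff hpos, mul_assoc]
    simp only [this]
    rw [tsum_mul_right, (Q.σ_hasSum e).tsum_eq, one_mul]
  simp only [← hrow]
  rw [← hF.tsum_comm]
  refine tsum_nonpos fun m => ?_
  have hcol : Summable fun e => F e m := 
    hF.comp_injective (i := fun e => (e, m)) (Prod.mk_left_injective m)
  have hs := (Q.summable_σ_mul (summable_excess P fun _ => Q.act_mem m) m).mul_right
    (f m - Q.payoff m)
  refine (hcol.tsum_le_tsum (g := fun e =>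
    Q.σ e m * excess p q π0 (Q.act m) e * (f m - Q.payoff m)) (fun e => ?_) hs).trans ?_
  · rw [hFdef]
    rcases (Q.σ_nonneg e m).eq_or_lt with h0 | hpos
    · simp [← h0]
    · by_cases hne : m = e
      · rw [hne]
      · refine mul_le_mul_of_nonpos_left ?_ (mul_nonpos_of_nonneg_of_nonpos hpos.le
          (Q.excess_nonpos_of_report P hpos hne))
        rw [← Q.act_eq_payoff hpos, ← Q.act_eq_payoff_self hpos]
        linarith [hmono (Q.feasible e m hpos)]
  · rw [tsum_mul_right, Q.tsum_σ_mul_excess P m, zero_mul]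

lemma payoff_eq_V (P : Params p q π0) (e : Ev) : Q.payoff e = V p q π0 e := by
  have hV : ∀ e, V p q π0 e ∈ Set.Icc (0 : ℝ) 1 := fun e => ⟨(P.V_pos e).le, P.V_le_one e⟩
  have hb : ∀ e, |V p q π0 e - Q.payoff e| ≤ 1 := fun e => abs_le.2
    ⟨by linarith [(hV e).1, (Q.payoff_mem e).2], by linarith [(hV e).2, (Q.payoff_mem e).1]⟩
  have hb' : ∀ e, |Q.payoff e - V p q π0 e| ≤ 1 := fun e => abs_sub_comm _ (Q.payoff e) ▸ hb e
  have h1 := Q.tsum_excess_payoff_mul_nonpos P hV P.V_mono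
  have h2 := P.tsum_excess_V_mul_nonpos (h := fun e => Q.payoff e - V p q π0 e) hb'
    (fun e => by
      rw [V_congr (N_cons_false e)]
      linarith [Q.payoff_mono (List.suffix_cons false e)])
    (fun e he => by
      rw [V_congr he]
      linarith [Q.payoff_mono (List.suffix_cons true e)])
  have hs1 := summable_mul_of_abs_le_one (summable_excess P Q.payoff_mem) hb
  have hs2 := summable_mul_of_abs_le_one (summable_excess P hV) hb'
  have hsum := hs1.tsum_add hs2
  have hsq : ∀ e, excess p q π0 (Q.payoff e) e * (V p q π0 e - Q.payoff e) +
      excess p q π0 (V p q π0 e) e * (Q.payoff e - V p q π0 e) =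
      mass p q π0 e * (Q.payoff e - V p q π0 e) ^ 2 := fun e => by
    simp only [excess]; ring
  simp only [hsq] at hsum
  by_contra hne
  have hs := hs1.add hs2
  simp only [hsq] at hs
  have hpos := hs.tsum_pos
    (fun e => mul_nonneg (P.mass_pos e).le (sq_nonneg _)) e
    (mul_pos (P.mass_pos e) (sq_pos_of_ne_zero (sub_ne_zero.2 hne)))
  linarith

end Eqm

/-- Proposition 5(1): in every truth-leaning equilibrium of the left-censored
model, `a(e) = μ(e) = min{V(e), ν({e})}` for every `e`. -/
theorem stmt_14 (p q π0 : ℝ) (hq0 : 0 < q) (hqp : q < p) (hp1 : p < 1)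
    (hpq0 : 0 < p + q) (hpq1 : p + q < 1) (h0 : 0 < π0) (h1 : π0 < 1)
    (Q : Eqm p q π0) :
    ∀ e : Ev, Q.act e = min (V p q π0 e) (nu p q π0 {e}) ∧
      Q.μ e = min (V p q π0 e) (nu p q π0 {e}) := by
  intro e
  have P : Params p q π0 := ⟨hq0, hqp, hpq1, h0, h1⟩
  have h := Q.act_eq_min P e
  rw [Q.payoff_eq_V P] at h
  exact ⟨h, (Q.receiver_opt e).symm.trans h⟩

end LeftCensored
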